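/- Radial Sobolev (Strauss) inequality: There is a constant C such that for every radially symmetric f ∈ 𝒮(ℝ³) (i.e. f(x) = f(y) whenever |x| = |y|) and every x ∈ ℝ³ with x ≠ 0: |f(x)| ≤ C(‖f‖_{L²(ℝ³)} + ‖∇f‖_{L²(ℝ³)})/|x|. -/

import Mathlib

open MeasureTheory
open scoped ENNReal

noncomputable section

abbrev Euc3 : Type := EuclideanSpace ℝ (Fin 3)

/-- The square of the `L²` norm is the integral of the squared norm. -/
theorem sq_toReal_eLpNorm_two {α F : Type*} [MeasurableSpace α] [NormedAddCommGroup F]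
    {μ : Measure α} {u : α → F} (hu : MemLp u 2 μ) :
    (eLpNorm u 2 μ).toReal ^ 2 = ∫ y, ‖u y‖ ^ 2 ∂μ := by
  have h0 : 0 ≤ ∫ y, ‖u y‖ ^ 2 ∂μ := integral_nonneg fun _ => by positivity
  rw [hu.eLpNorm_eq_integral_rpow_norm (by norm_num) (by norm_num)]
  simp only [ENNReal.toReal_ofNat, Real.rpow_ofNat]
  rw [ENNReal.toReal_ofReal (by positivity), ← Real.rpow_natCast, ← Real.rpow_mul h0]
  norm_num

/-- One-dimensional weighted estimate behind the radial Sobolev inequality. -/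
theorem sq_mul_sq_le_integral_Ioi {g h : ℝ → ℝ} (hderiv : ∀ r, HasDerivAt g (h r) r)
    (hh : Continuous h) (hg : Filter.Tendsto g Filter.atTop (nhds 0))
    (hint : IntegrableOn (fun s => s ^ 2 * (g s ^ 2 + h s ^ 2)) (Set.Ioi 0))
    {R : ℝ} (hR : 0 < R) :
    R ^ 2 * g R ^ 2 ≤ ∫ s in Set.Ioi (0 : ℝ), s ^ 2 * (g s ^ 2 + h s ^ 2) := by
  have hgc : Continuous g := continuous_iff_continuousAt.2 fun r => (hderiv r).continuousAt
  have hsub : Set.Ioi R ⊆ Set.Ioi 0 := Set.Ioi_subset_Ioi hR.le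
  have hbound : ∀ s ∈ Set.Ioi R,
      ‖R ^ 2 * (2 * g s * h s)‖ ≤ s ^ 2 * (g s ^ 2 + h s ^ 2) := by
    intro s hs
    have hs : R < s := hs
    have h1 : |2 * g s * h s| ≤ g s ^ 2 + h s ^ 2 :=
      abs_le.2 ⟨by nlinarith [sq_nonneg (g s + h s)], by nlinarith [sq_nonneg (g s - h s)]⟩
    rw [Real.norm_eq_abs, abs_mul, abs_of_nonneg (sq_nonneg R)]
    gcongr
  have hI : IntegrableOn (fun s => R ^ 2 * (2 * g s * h s)) (Set.Ioi R) :=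
    (hint.mono_set hsub).mono' (by fun_prop)
      ((ae_restrict_iff' measurableSet_Ioi).2 (.of_forall hbound))
  have hFTC := integral_Ioi_of_hasDerivAt_of_tendsto' (a := R) (m := 0)
    (f := fun s => R ^ 2 * g s ^ 2) (f' := fun s => R ^ 2 * (2 * g s * h s))
    (fun s _ => by simpa using ((hderiv s).pow 2).const_mul (R ^ 2)) hI
    (by simpa using (hg.pow 2).const_mul (R ^ 2))
  calc R ^ 2 * g R ^ 2 = ‖∫ s in Set.Ioi R, R ^ 2 * (2 * g s * h s)‖ := by
        rw [hFTC, zero_sub, norm_neg, Real.norm_of_nonneg (by positivity)]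
    _ ≤ ∫ s in Set.Ioi R, s ^ 2 * (g s ^ 2 + h s ^ 2) :=
        norm_integral_le_of_norm_le (hint.mono_set hsub)
          ((ae_restrict_iff' measurableSet_Ioi).2 (.of_forall hbound))
    _ ≤ ∫ s in Set.Ioi (0 : ℝ), s ^ 2 * (g s ^ 2 + h s ^ 2) :=
        setIntegral_mono_set hint (.of_forall fun s => by positivity) hsub.eventuallyLE

/-- The derivative of a function along a ray. -/
theorem DifferentiableAt.hasDerivAt_smul_const {E : Type*} [NormedAddCommGroup E] [NormedSpace ℝ E]
    {f : E → ℝ} {e : E} {r : ℝ} (hf : DifferentiableAt ℝ f (r • e)) :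
    HasDerivAt (fun s : ℝ => f (s • e)) (fderiv ℝ f (r • e) e) r := by
  have := hf.hasFDerivAt.comp_hasDerivAt r ((hasDerivAt_id r).smul_const e)
  simpa [Function.comp_def] using this

/-- The radial derivative of a radially symmetric function is bounded by its full derivative. -/
theorem abs_fderiv_smul_le_of_radial {E : Type*} [NormedAddCommGroup E] [NormedSpace ℝ E]
    {f : E → ℝ} (hf : Differentiable ℝ f) (hrad : ∀ x y : E, ‖x‖ = ‖y‖ → f x = f y)
    {e : E} (he : ‖e‖ = 1) (y : E) :
    |fderiv ℝ f (‖y‖ • e) e| ≤ ‖fderiv ℝ f y‖ := by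
  have key : ∀ v : E, ‖v‖ = 1 → |fderiv ℝ f y v| ≤ ‖fderiv ℝ f y‖ := fun v hv => by
    simpa [hv] using (fderiv ℝ f y).le_opNorm v
  rcases eq_or_ne y 0 with rfl | hy
  · simpa using key e he
  have hy' : ‖y‖ ≠ 0 := norm_ne_zero_iff.2 hy
  set v : E := ‖y‖⁻¹ • y
  have hv : ‖v‖ = 1 := norm_smul_inv_norm (𝕜 := ℝ) hy
  have hyv : ‖y‖ • v = y := smul_inv_smul₀ hy' y
  have heq : (fun s : ℝ => f (s • e)) = fun s : ℝ => f (s • v) :=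
    funext fun s => hrad _ _ (by simp [norm_smul, he, hv])
  have h1 := (hf (‖y‖ • e)).hasDerivAt_smul_const
  rw [heq] at h1
  rw [h1.unique (hf (‖y‖ • v)).hasDerivAt_smul_const, hyv]
  exact key v hv

/-- **Radial Sobolev (Strauss) inequality.**
There is a constant `C` such that for every radially symmetric Schwartz function `f` on `ℝ³`
and every `x ≠ 0`, `|f x| ≤ C (‖f‖_{L²} + ‖∇f‖_{L²}) / ‖x‖`. -/
theorem radial_sobolev_strauss :
    ∃ C : ℝ, 0 ≤ C ∧ ∀ f : SchwartzMap Euc3 ℝ,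
      (∀ x y : Euc3, ‖x‖ = ‖y‖ → f x = f y) →
      ∀ x : Euc3, x ≠ 0 →
        |f x| ≤ C * ((eLpNorm ⇑f 2 volume).toReal
          + (eLpNorm (fun y => fderiv ℝ ⇑f y) 2 volume).toReal) / ‖x‖ := by
  have hc : 0 < 3 * volume.real (Metric.ball (0 : Euc3) 1) :=
    mul_pos three_pos (ENNReal.toReal_pos (Metric.measure_ball_pos _ _ one_pos).ne'
      measure_ball_lt_top.ne)
  set c : ℝ := 3 * volume.real (Metric.ball (0 : Euc3) 1) with hcdef
  refine ⟨(√c)⁻¹, by positivity, fun f hrad x hx => ?_⟩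
  have hR : 0 < ‖x‖ := norm_pos_iff.2 hx
  set e : Euc3 := ‖x‖⁻¹ • x
  have he : ‖e‖ = 1 := norm_smul_inv_norm (𝕜 := ℝ) hx
  set g : ℝ → ℝ := fun s => f (s • e)
  set h : ℝ → ℝ := fun s => fderiv ℝ f (s • e) e
  have hgf : ∀ y : Euc3, g ‖y‖ = f y := fun y => hrad _ _ (by simp [norm_smul, he])
  have hh : Continuous h :=
    (((f.smooth 1).continuous_fderiv (by norm_num)).comp (by fun_prop)).clm_apply continuous_const
  have hhf : ∀ y : Euc3, h ‖y‖ ^ 2 ≤ ‖fderiv ℝ f y‖ ^ 2 := fun y => by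
    rw [← sq_abs]
    gcongr
    exact abs_fderiv_smul_le_of_radial f.differentiable hrad he y
  have hg0 : Filter.Tendsto g Filter.atTop (nhds 0) := by
    refine (ZeroAtInftyContinuousMapClass.zero_at_infty f).comp ?_
    rw [← Metric.cobounded_eq_cocompact, ← tendsto_norm_atTop_iff_cobounded]
    simpa [norm_smul, he] using Filter.tendsto_abs_atTop_atTop
  have hf2 : MemLp f 2 (volume : Measure Euc3) := f.memLp 2 volume
  have hf2' : MemLp (fun y => fderiv ℝ f y) 2 (volume : Measure Euc3) :=
    (SchwartzMap.fderivCLM ℝ Euc3 ℝ f).memLp 2 volume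
  have hIf : Integrable (fun y : Euc3 => g ‖y‖ ^ 2) := by
    simpa [hgf] using hf2.integrable_norm_pow (by norm_num)
  have hId : Integrable (fun y : Euc3 => ‖fderiv ℝ f y‖ ^ 2) :=
    hf2'.integrable_norm_pow (by norm_num)
  have hIh : Integrable (fun y : Euc3 => h ‖y‖ ^ 2) :=
    hId.mono' (by fun_prop) (.of_forall fun y => by simpa using hhf y)
  have hpolar := integral_fun_norm_addHaar (volume : Measure Euc3) fun s => g s ^ 2 + h s ^ 2
  have hint := (integrable_fun_norm_addHaar (volume : Measure Euc3)
    (f := fun s => g s ^ 2 + h s ^ 2)).1 (hIf.add hIh)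
  simp only [finrank_euclideanSpace_fin, Nat.add_one_sub_one, smul_eq_mul, nsmul_eq_mul,
    Nat.cast_ofNat, ← mul_assoc] at hpolar hint
  have hmain := sq_mul_sq_le_integral_Ioi
    (fun r => (f.differentiable (r • e)).hasDerivAt_smul_const) hh hg0 hint hR
  set A : ℝ := (eLpNorm f 2 volume).toReal
  set B : ℝ := (eLpNorm (fun y => fderiv ℝ f y) 2 volume).toReal
  have hA : 0 ≤ A := ENNReal.toReal_nonneg
  have hB : 0 ≤ B := ENNReal.toReal_nonneg
  have hle : ∫ y : Euc3, (g ‖y‖ ^ 2 + h ‖y‖ ^ 2) ≤ A ^ 2 + B ^ 2 := by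
    rw [integral_add hIf hIh, sq_toReal_eLpNorm_two hf2, sq_toReal_eLpNorm_two hf2']
    refine add_le_add (by simp [hgf]) (integral_mono hIh hId hhf)
  have hfin : c * (‖x‖ ^ 2 * f x ^ 2) ≤ (A + B) ^ 2 := by
    rw [← hgf x]
    calc c * (‖x‖ ^ 2 * g ‖x‖ ^ 2) ≤ A ^ 2 + B ^ 2 :=
          (mul_le_mul_of_nonneg_left hmain hc.le).trans (hpolar.symm.trans_le hle)
      _ ≤ (A + B) ^ 2 := by nlinarith [mul_nonneg hA hB]
  rw [inv_mul_eq_div, div_div, le_div_iff₀ (by positivity)]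
  refine (sq_le_sq₀ (by positivity) (by positivity)).1 ?_
  rw [mul_pow, mul_pow, Real.sq_sqrt hc.le, sq_abs]
  linarith

end
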